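/- Let μ > 0, 1 < p < ∞, σ > 1/p − 1, λ = (μ+σ+1)/2, and let F_σ be as above. Then the operator norm of F_σ on L^p_μ(0,1) is at least (Γ(μ+1)/Γ(λ)²) Γ(1/p) Γ(σ + 1 − 1/p); combined with the upper bound, ‖F_σ‖_{L^p_μ → L^p_μ} = (Γ(μ+1)/Γ(λ)²) Γ(1/p) Γ(σ + 1 − 1/p). -/

import Mathlib

open MeasureTheory Real Set ENNReal

/-- The real Gauss hypergeometric function `₂F₁(a, b; c; x)`, defined by its power
series. -/
noncomputable def hyp2F1 (a b c x : ℝ) : ℝ :=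
  ∑' k : ℕ, ((ascPochhammer ℝ k).eval a * (ascPochhammer ℝ k).eval b /
    ((ascPochhammer ℝ k).eval c * (k.factorial : ℝ))) * x ^ k

/-- The weighted measure `dμ(t) = μ t^(μ-1) dt` on `(0, 1)`, so that
`L^p_μ(0,1) = L^p` of this measure. -/
noncomputable def wMeasure (μ : ℝ) : Measure ℝ :=
  (volume.restrict (Ioo (0:ℝ) 1)).withDensity fun t => ENNReal.ofReal (μ * t ^ (μ - 1))

/-- The integral operator `F_σ φ(s) = μ ∫₀¹ (1-t)^σ ₂F₁(λ,λ;μ;st) φ(t) t^(μ-1) dt`,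
acting on non-negative functions (which determines its norm on `L^p_μ(0,1)`, the kernel
being non-negative). -/
noncomputable def Fop (μ σ lam : ℝ) (f : ℝ → ℝ≥0∞) (s : ℝ) : ℝ≥0∞ :=
  ∫⁻ t, ENNReal.ofReal ((1 - t) ^ σ * hyp2F1 lam lam μ (s * t)) * f t ∂(wMeasure μ)


open Filter Topology ProbabilityTheory

section GammaFacts

theorem Gamma_add_nat_eq {a : ℝ} (ha : 0 < a) (k : ℕ) :
    Gamma (a + k) = (ascPochhammer ℝ k).eval a * Gamma a := by
  induction k with
  | zero => simp
  | succ k ih =>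
    rw [Nat.cast_succ, ← add_assoc, Gamma_add_one (by positivity), ih, ascPochhammer_succ_eval]
    ring

theorem continuousAt_Gamma_of_pos {a : ℝ} (ha : 0 < a) : ContinuousAt Gamma a :=
  (differentiableAt_Gamma fun m => by have := m.cast_nonneg (α := ℝ); linarith).continuousAt

/-- The binomial series, with Gamma functions as coefficients. -/
theorem hasSum_Gamma_add_nat {a x : ℝ} (ha : 0 < a) (hx : |x| < 1) :
    HasSum (fun k : ℕ => Gamma (a + k) / k.factorial * x ^ k) (Gamma a * (1 - x) ^ (-a)) := by
  have hball : x ∈ Metric.eball (0 : ℝ) 1 := by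
    simpa [← ofReal_norm] using hx
  have h := (one_div_one_sub_rpow_hasFPowerSeriesOnBall_zero a).hasSum hball
  convert! h.mul_left (Gamma a) using 1
  · funext k
    have hc : Ring.choose (a + k - 1) k * (k.factorial : ℝ) = (ascPochhammer ℝ k).eval a := by
      have := Ring.factorial_nsmul_multichoose_eq_ascPochhammer a k
      rw [Polynomial.ascPochhammer_smeval_eq_eval, nsmul_eq_mul] at this
      rw [← this, Ring.choose, mul_comm]
      congr 2
      ring
    have hk : (k.factorial : ℝ) ≠ 0 := by positivity
    rw [Gamma_add_nat_eq ha, ← hc]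
    simp only [FormalMultilinearSeries.ofScalars_apply_eq, smul_eq_mul]
    field_simp
  · rw [Real.rpow_neg (by linarith [(abs_lt.1 hx).2]), zero_add, one_div]

/-- Midpoint log-convexity of the Gamma function. -/
theorem Gamma_sq_le_mul {x y z : ℝ} (hx : 0 < x) (hy : 0 < y) (hz : 2 * z = x + y) :
    Gamma z ^ 2 ≤ Gamma x * Gamma y := by
  have h := Gamma_mul_add_mul_le_rpow_Gamma_mul_rpow_Gamma hx hy
    (a := 1 / 2) (b := 1 / 2) (by norm_num) (by norm_num) (by norm_num)
  rw [show 1 / 2 * x + 1 / 2 * y = z by linarith, ← sqrt_eq_rpow, ← sqrt_eq_rpow] at h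
  have hz0 : 0 ≤ Gamma z := (Gamma_pos_of_pos (by linarith)).le
  calc Gamma z ^ 2 ≤ (√(Gamma x) * √(Gamma y)) ^ 2 := by gcongr
    _ = Gamma x * Gamma y := by
      rw [mul_pow, sq_sqrt (Gamma_pos_of_pos hx).le, sq_sqrt (Gamma_pos_of_pos hy).le]

/-- Among pairs with a given mean, the product of Gamma values grows with the distance. -/
theorem Gamma_mul_Gamma_le {z h H : ℝ} (hH : 0 < H) (hz : H < z) (hh : |h| ≤ H) :
    Gamma (z + h) * Gamma (z - h) ≤ Gamma (z + H) * Gamma (z - H) := by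
  obtain ⟨h1, h2⟩ := abs_le.1 hh
  have hp : 0 < z + H := by linarith
  have hm : 0 < z - H := by linarith
  have key : ∀ g : ℝ, |g| < H → Gamma (z + g) ≤
      Gamma (z + H) ^ ((H + g) / (2 * H)) * Gamma (z - H) ^ ((H - g) / (2 * H)) := by
    intro g hg
    obtain ⟨g1, g2⟩ := abs_lt.1 hg
    have := Gamma_mul_add_mul_le_rpow_Gamma_mul_rpow_Gamma hp hm
      (a := (H + g) / (2 * H)) (b := (H - g) / (2 * H))
      (div_pos (by linarith) (by linarith)) (div_pos (by linarith) (by linarith))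
      (by field_simp; ring)
    convert this using 2
    field_simp
    ring
  rcases hh.lt_or_eq with hlt | heq
  · have k1 := key h hlt
    have k2 := key (-h) (by rwa [abs_neg])
    have e1 : (H + h) / (2 * H) + (H - h) / (2 * H) = 1 := by field_simp; ring
    have e2 : (H - h) / (2 * H) + (H + h) / (2 * H) = 1 := by rw [add_comm, e1]
    rw [sub_neg_eq_add, ← sub_eq_add_neg, ← sub_eq_add_neg] at k2
    have hGp := Gamma_pos_of_pos hp
    have hGm := Gamma_pos_of_pos hm
    calc Gamma (z + h) * Gamma (z - h) ≤ _ :=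
          mul_le_mul k1 k2 (Gamma_pos_of_pos (by linarith)).le (by positivity)
      _ = (Gamma (z + H) ^ ((H + h) / (2 * H)) * Gamma (z + H) ^ ((H - h) / (2 * H))) *
          (Gamma (z - H) ^ ((H - h) / (2 * H)) * Gamma (z - H) ^ ((H + h) / (2 * H))) := by ring
      _ = Gamma (z + H) * Gamma (z - H) := by
        rw [← rpow_add hGp, ← rpow_add hGm, e1, e2, Real.rpow_one, Real.rpow_one]
  · rcases eq_or_eq_neg_of_abs_eq heq with rfl | rfl
    · exact le_rfl
    · rw [sub_neg_eq_add, ← sub_eq_add_neg, mul_comm]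

theorem tendsto_Gamma_mul_Gamma_div_sq (H : ℕ) :
    Tendsto (fun z : ℝ => Gamma (z + H) * Gamma (z - H) / Gamma z ^ 2) atTop (𝓝 1) := by
  induction H with
  | zero =>
    refine tendsto_const_nhds.congr' ?_
    filter_upwards [eventually_gt_atTop 0] with z hz
    have := (Gamma_pos_of_pos hz).ne'
    simp [← sq, this]
  | succ H ih =>
    have hlim : Tendsto (fun z : ℝ => 1 + (2 * H + 1) / (z - (H + 1))) atTop (𝓝 1) := by
      have h0 : Tendsto (fun z : ℝ => (2 * H + 1) / (z - (H + 1))) atTop (𝓝 0) :=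
        tendsto_const_nhds.div_atTop (tendsto_atTop_add_const_right _ _ tendsto_id)
      simpa using tendsto_const_nhds.add h0
    rw [← one_mul (1 : ℝ)]
    refine (ih.mul hlim).congr' ?_
    filter_upwards [eventually_gt_atTop ((H : ℝ) + 1)] with z hz
    have hH : (0 : ℝ) ≤ H := Nat.cast_nonneg H
    have hz' : z - (H + 1) ≠ 0 := by linarith
    have hG := (Gamma_pos_of_pos (show 0 < z by linarith)).ne'
    have e1 : Gamma (z + (H + 1)) = (z + H) * Gamma (z + H) := by
      rw [← add_assoc, Gamma_add_one (by linarith)]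
    have e2 : Gamma (z - H) = (z - (H + 1)) * Gamma (z - (H + 1)) := by
      rw [← Gamma_add_one hz']
      ring_nf
    push_cast
    rw [e1, e2]
    field_simp
    ring

/-- The gap in the midpoint log-convexity of Gamma closes at infinity, uniformly over pairs at
bounded distance. -/
theorem exists_Gamma_mul_le_sq (lam B : ℝ) {θ : ℝ} (hθ : θ < 1) :
    ∃ N : ℕ, ∀ k : ℕ, N ≤ k → ∀ x y : ℝ, x + y = 2 * (lam + k) → |x - y| ≤ B →
      θ * (Gamma x * Gamma y) ≤ Gamma (lam + k) ^ 2 := by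
  obtain ⟨H, hH⟩ := exists_nat_gt (max B 0)
  obtain ⟨hHB, hH0⟩ := max_lt_iff.1 hH
  have hk : Tendsto (fun k : ℕ => lam + (k : ℝ)) atTop atTop :=
    tendsto_atTop_add_const_left _ _ tendsto_natCast_atTop_atTop
  have hlim : Tendsto (fun k : ℕ => θ * (Gamma (lam + k + H) * Gamma (lam + k - H) /
      Gamma (lam + k) ^ 2)) atTop (𝓝 (θ * 1)) :=
    ((tendsto_Gamma_mul_Gamma_div_sq H).comp hk).const_mul θ
  have hev := (hlim.eventually_lt_const (u := 1) (by linarith)).and (hk.eventually_gt_atTop (H : ℝ))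
  obtain ⟨N, hN⟩ := eventually_atTop.1 hev
  refine ⟨N, fun k hkN x y hxy hB => ?_⟩
  obtain ⟨h1, h2⟩ := hN k hkN
  have hG : 0 < Gamma (lam + k) := Gamma_pos_of_pos (hH0.trans h2)
  have hle := Gamma_mul_Gamma_le (z := lam + k) (h := (x - y) / 2) hH0 h2 (by
    rw [abs_div, abs_two]; linarith [abs_nonneg (x - y)])
  rw [show lam + k + (x - y) / 2 = x by linarith, show lam + k - (x - y) / 2 = y by linarith] at hle
  rcases le_or_gt θ 0 with h0 | h0
  · obtain ⟨b1, b2⟩ := abs_le.1 hB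
    have hx : 0 < Gamma x := Gamma_pos_of_pos (by linarith)
    have hy : 0 < Gamma y := Gamma_pos_of_pos (by linarith)
    exact (mul_nonpos_of_nonpos_of_nonneg h0 (by positivity)).trans (by positivity)
  · rw [← mul_div_assoc, div_lt_one (by positivity)] at h1
    exact (mul_le_mul_of_nonneg_left hle h0.le).trans h1.le

end GammaFacts

section WeightedMeasure

theorem ae_wMeasure_mem_Ioo (μ : ℝ) : ∀ᵐ t ∂(wMeasure μ), t ∈ Ioo (0 : ℝ) 1 :=
  (withDensity_absolutelyContinuous _ _).ae_le (ae_restrict_mem measurableSet_Ioo)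

instance (μ : ℝ) : SFinite (wMeasure μ) := by
  unfold wMeasure
  infer_instance

/-- The Euler beta integral, against the weighted measure. -/
theorem lintegral_one_sub_rpow_mul_pow {μ b : ℝ} (hμ : 0 < μ) (hb : 0 < b) (k : ℕ) :
    ∫⁻ t, ENNReal.ofReal ((1 - t) ^ (b - 1)) * ENNReal.ofReal t ^ k ∂(wMeasure μ) =
      ENNReal.ofReal (μ * (Gamma (μ + k) * Gamma b / Gamma (μ + b + k))) := by
  have hk : 0 < μ + k := by positivity
  have hB : 0 < beta (μ + k) b := beta_pos hk hb
  have h1 := lintegral_betaPDF_eq_one hk hb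
  rw [lintegral_betaPDF] at h1
  rw [wMeasure, lintegral_withDensity_eq_lintegral_mul _ (by fun_prop) (by fun_prop)]
  have hcongr : ∀ t ∈ Ioo (0 : ℝ) 1,
      ((fun t => ENNReal.ofReal (μ * t ^ (μ - 1))) *
        fun t => ENNReal.ofReal ((1 - t) ^ (b - 1)) * ENNReal.ofReal t ^ k) t =
      ENNReal.ofReal (μ * beta (μ + k) b) *
        ENNReal.ofReal (1 / beta (μ + k) b * t ^ (μ + k - 1) * (1 - t) ^ (b - 1)) := by
    rintro t ⟨ht0, ht1⟩
    have h1t : 0 < 1 - t := by linarith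
    rw [Pi.mul_apply, ← ENNReal.ofReal_pow ht0.le, ← ENNReal.ofReal_mul (by positivity),
      ← ENNReal.ofReal_mul (by positivity), ← ENNReal.ofReal_mul (by positivity),
      show μ + k - 1 = μ - 1 + k by ring, Real.rpow_add ht0, Real.rpow_natCast]
    congr 1
    field_simp
  rw [setLIntegral_congr_fun measurableSet_Ioo hcongr, lintegral_const_mul _ (by fun_prop), h1,
    mul_one, beta, show μ + k + b = μ + b + k by ring]

end WeightedMeasure

section Kernel

/-- The symmetric part of the kernel of `F_σ`, up to a constant factor. -/
noncomputable def gammaKernel (lam μ s t : ℝ) : ℝ≥0∞ :=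
  ∑' k : ℕ, ENNReal.ofReal (Gamma (lam + k) ^ 2 / (Gamma (μ + k) * k.factorial)) *
    (ENNReal.ofReal s ^ k * ENNReal.ofReal t ^ k)

theorem gammaKernel_comm (lam μ s t : ℝ) : gammaKernel lam μ s t = gammaKernel lam μ t s := by
  simp only [gammaKernel, mul_comm (ENNReal.ofReal s ^ _)]

theorem measurable_gammaKernel (lam μ : ℝ) :
    Measurable fun z : ℝ × ℝ => gammaKernel lam μ z.1 z.2 := by
  unfold gammaKernel
  exact Measurable.tsum fun k => by fun_prop

theorem measurable_rpow_mul_gammaKernel (lam μ s x : ℝ) :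
    Measurable fun t : ℝ => ENNReal.ofReal ((1 - t) ^ x) * gammaKernel lam μ s t := by
  unfold gammaKernel
  exact Measurable.mul (by fun_prop) (Measurable.tsum fun k => by fun_prop)

/-- The power series obtained by integrating the kernel against a power of `1 - t`. -/
noncomputable def gammaSeries (lam c s : ℝ) : ℝ≥0∞ :=
  ∑' k : ℕ, ENNReal.ofReal (Gamma (lam + k) ^ 2 / (Gamma (c + k) * k.factorial)) *
    ENNReal.ofReal s ^ k

theorem measurable_gammaSeries (lam c : ℝ) : Measurable (gammaSeries lam c) := by
  unfold gammaSeries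
  exact Measurable.tsum fun k => by fun_prop

theorem tsum_ofReal_Gamma {a s : ℝ} (ha : 0 < a) (hs : s ∈ Ioo (0 : ℝ) 1) :
    ∑' k : ℕ, ENNReal.ofReal (Gamma (a + k) / k.factorial * s ^ k) =
      ENNReal.ofReal (Gamma a * (1 - s) ^ (-a)) := by
  have h := hasSum_Gamma_add_nat ha (x := s) (by rw [abs_lt]; constructor <;> linarith [hs.1, hs.2])
  rw [← h.tsum_eq, ENNReal.ofReal_tsum_of_nonneg _ h.summable]
  intro k
  have := Gamma_pos_of_pos (show 0 < a + k by positivity)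
  have := hs.1
  positivity

theorem Gamma_sq_div_le {lam a c : ℝ} (ha : 0 < a) (hc : 0 < c) (h : 2 * lam = a + c) (k : ℕ) :
    Gamma (lam + k) ^ 2 / (Gamma (c + k) * k.factorial) ≤ Gamma (a + k) / k.factorial := by
  have h1 : 0 < Gamma (c + k) := Gamma_pos_of_pos (by positivity)
  have h2 := Gamma_sq_le_mul (x := a + k) (y := c + k) (z := lam + k) (by positivity)
    (by positivity) (by linarith)
  rw [div_le_div_iff₀ (by positivity) (by positivity)]
  have h3 := mul_le_mul_of_nonneg_right h2 (Nat.cast_nonneg (α := ℝ) k.factorial)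
  linarith

theorem ofReal_hyp2F1 {lam μ s t : ℝ} (hμ : 0 < μ) (hlam : μ < 2 * lam) (hs : s ∈ Ioo (0 : ℝ) 1)
    (ht : t ∈ Ioo (0 : ℝ) 1) :
    ENNReal.ofReal (hyp2F1 lam lam μ (s * t)) =
      ENNReal.ofReal (Gamma μ / Gamma lam ^ 2) * gammaKernel lam μ s t := by
  obtain ⟨hs0, hs1⟩ := hs
  obtain ⟨ht0, ht1⟩ := ht
  have hl : 0 < lam := by linarith
  have hGl := Gamma_pos_of_pos hl
  have hGμ := Gamma_pos_of_pos hμ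
  have hst : s * t < 1 := by nlinarith
  have hst0 : 0 < s * t := mul_pos hs0 ht0
  have hGk : ∀ k : ℕ, 0 < Gamma (μ + k) := fun k => Gamma_pos_of_pos (by positivity)
  have hsummable : Summable fun k : ℕ =>
      Gamma (lam + k) ^ 2 / (Gamma (μ + k) * k.factorial) * (s * t) ^ k := by
    refine Summable.of_nonneg_of_le (fun k => ?_) (fun k => ?_)
      (hasSum_Gamma_add_nat (a := 2 * lam - μ) (x := s * t) (by linarith)
        (by rw [abs_of_pos hst0]; exact hst)).summable
    · have := hGk k
      positivity
    · exact mul_le_mul_of_nonneg_right (Gamma_sq_div_le (by linarith) hμ (by ring) k)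
        (by positivity)
  have hrw : hyp2F1 lam lam μ (s * t) = Gamma μ / Gamma lam ^ 2 *
      ∑' k : ℕ, Gamma (lam + k) ^ 2 / (Gamma (μ + k) * k.factorial) * (s * t) ^ k := by
    rw [hyp2F1, ← tsum_mul_left]
    congr 1 with k
    have hμk : (ascPochhammer ℝ k).eval μ ≠ 0 := (ascPochhammer_pos k μ hμ).ne'
    have hk : (k.factorial : ℝ) ≠ 0 := by positivity
    rw [Gamma_add_nat_eq hl, Gamma_add_nat_eq hμ]
    field_simp
  rw [hrw, ENNReal.ofReal_mul (by positivity), gammaKernel,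
    ENNReal.ofReal_tsum_of_nonneg (fun k => by have := hGk k; positivity) hsummable]
  congr 2 with k
  have := hGk k
  rw [ENNReal.ofReal_mul (by positivity), mul_pow, ENNReal.ofReal_mul (by positivity),
    ENNReal.ofReal_pow hs0.le, ENNReal.ofReal_pow ht0.le]

theorem lintegral_gammaKernel {lam μ b : ℝ} (hμ : 0 < μ) (hb : 0 < b) (s : ℝ) :
    ∫⁻ t, ENNReal.ofReal ((1 - t) ^ (b - 1)) * gammaKernel lam μ s t ∂(wMeasure μ) =
      ENNReal.ofReal (μ * Gamma b) * gammaSeries lam (μ + b) s := by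
  simp only [gammaKernel, gammaSeries, ← ENNReal.tsum_mul_left]
  rw [lintegral_tsum fun k => by fun_prop]
  congr 1 with k
  have h1 : 0 < Gamma (μ + k) := Gamma_pos_of_pos (by positivity)
  have h2 : 0 < Gamma (μ + b + k) := Gamma_pos_of_pos (by positivity)
  have h3 : 0 < Gamma b := Gamma_pos_of_pos hb
  have hcomm : ∀ t : ℝ, ENNReal.ofReal ((1 - t) ^ (b - 1)) *
      (ENNReal.ofReal (Gamma (lam + k) ^ 2 / (Gamma (μ + k) * k.factorial)) *
        (ENNReal.ofReal s ^ k * ENNReal.ofReal t ^ k)) =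
      ENNReal.ofReal (Gamma (lam + k) ^ 2 / (Gamma (μ + k) * k.factorial)) *
        ENNReal.ofReal s ^ k * (ENNReal.ofReal ((1 - t) ^ (b - 1)) * ENNReal.ofReal t ^ k) :=
    fun t => by ring
  simp_rw [hcomm]
  rw [lintegral_const_mul _ (by fun_prop), lintegral_one_sub_rpow_mul_pow hμ hb,
    mul_right_comm, ← mul_assoc, ← ENNReal.ofReal_mul (by positivity),
    ← ENNReal.ofReal_mul (by positivity)]
  congr 2
  field_simp

theorem gammaSeries_le {lam a c s : ℝ} (ha : 0 < a) (hc : 0 < c) (h : 2 * lam = a + c)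
    (hs : s ∈ Ioo (0 : ℝ) 1) :
    gammaSeries lam c s ≤ ENNReal.ofReal (Gamma a) * ENNReal.ofReal ((1 - s) ^ (-a)) := by
  have hG := Gamma_pos_of_pos ha
  rw [← ENNReal.ofReal_mul hG.le, ← tsum_ofReal_Gamma ha hs]
  refine ENNReal.tsum_le_tsum fun k => ?_
  have := Gamma_pos_of_pos (show 0 < a + k by positivity)
  rw [ENNReal.ofReal_mul (by positivity), ENNReal.ofReal_pow hs.1.le]
  exact mul_le_mul_left (ENNReal.ofReal_le_ofReal (Gamma_sq_div_le ha hc h k)) _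

/-- Up to an additive constant, uniform in the exponent, `gammaSeries` is almost as large as the
binomial series bounding it. -/
theorem exists_le_gammaSeries_add (lam : ℝ) {a₀ θ : ℝ} (ha₀ : 0 < a₀) (hθ0 : 0 < θ) (hθ : θ < 1) :
    ∃ M : ℝ, 0 ≤ M ∧ ∀ a ∈ Icc (a₀ / 2) a₀, ∀ c, 0 < c → 2 * lam = a + c → ∀ s ∈ Ioo (0 : ℝ) 1,
      ENNReal.ofReal (θ * Gamma a) * ENNReal.ofReal ((1 - s) ^ (-a)) ≤
        gammaSeries lam c s + ENNReal.ofReal M := by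
  obtain ⟨N, hN⟩ := exists_Gamma_mul_le_sq lam (2 * a₀ + 2 * |lam|) hθ
  have hbdd : ∀ k : ℕ, ∃ m : ℝ, ∀ a ∈ Icc (a₀ / 2) a₀, Gamma (a + k) ≤ m := fun k => by
    have hcont : ContinuousOn (fun a : ℝ => Gamma (a + k)) (Icc (a₀ / 2) a₀) := fun a ha => by
      have : 0 < a + k := add_pos_of_pos_of_nonneg (by linarith [ha.1]) k.cast_nonneg
      exact (ContinuousAt.comp (f := fun x : ℝ => x + k) (continuousAt_Gamma_of_pos this)
        (by fun_prop)).continuousWithinAt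
    obtain ⟨m, hm⟩ := (isCompact_Icc.image_of_continuousOn hcont).bddAbove
    exact ⟨m, fun a ha => hm (mem_image_of_mem _ ha)⟩
  choose m hm using hbdd
  have hm0 : ∀ k, 0 ≤ m k := fun k =>
    (Gamma_pos_of_pos (by positivity)).le.trans (hm k a₀ ⟨by linarith, le_rfl⟩)
  refine ⟨∑ k ∈ Finset.range N, m k, Finset.sum_nonneg fun k _ => hm0 k, ?_⟩
  intro a haI c hc hlam s hs
  have ha : 0 < a := by linarith [haI.1]
  have hM : ENNReal.ofReal (∑ k ∈ Finset.range N, m k) =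
      ∑' k : ℕ, if k < N then ENNReal.ofReal (m k) else 0 := by
    rw [tsum_eq_sum (s := Finset.range N) (fun k hk => if_neg (by simpa using hk)),
      ENNReal.ofReal_sum_of_nonneg fun k _ => hm0 k]
    exact Finset.sum_congr rfl fun k hk => (if_pos (by simpa using hk)).symm
  have hG := Gamma_pos_of_pos ha
  rw [ENNReal.ofReal_mul hθ0.le, mul_assoc, ← ENNReal.ofReal_mul hG.le, ← tsum_ofReal_Gamma ha hs,
    ← ENNReal.tsum_mul_left, hM, gammaSeries, ← ENNReal.tsum_add]
  refine ENNReal.tsum_le_tsum fun k => ?_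
  have hGa := Gamma_pos_of_pos (show 0 < a + k by positivity)
  have hGc := Gamma_pos_of_pos (show 0 < c + k by positivity)
  have hfac : (1 : ℝ) ≤ k.factorial := by exact_mod_cast k.factorial_pos
  have hspos := hs.1
  rw [← ENNReal.ofReal_mul hθ0.le]
  rcases lt_or_ge k N with hk | hk
  · rw [if_pos hk]
    refine le_add_left (ENNReal.ofReal_le_ofReal ?_)
    have h1 : Gamma (a + k) / k.factorial ≤ m k :=
      (div_le_self hGa.le hfac).trans (hm k a haI)
    have h2 : s ^ k ≤ 1 := pow_le_one₀ hs.1.le hs.2.le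
    calc θ * (Gamma (a + k) / k.factorial * s ^ k) ≤ 1 * (m k * 1) := by
          gcongr
          exact hm0 k
      _ = m k := by ring
  · rw [if_neg hk.not_gt, add_zero, ← ENNReal.ofReal_pow hs.1.le,
      ← ENNReal.ofReal_mul (by positivity)]
    refine ENNReal.ofReal_le_ofReal ?_
    have h1 := hN k hk (a + k) (c + k) (by linarith) (by
      rw [show a + k - (c + k) = 2 * a - 2 * lam by linarith, abs_le]
      constructor <;> linarith [haI.1, haI.2, le_abs_self lam, neg_abs_le lam])
    rw [← mul_assoc]
    gcongr
    rw [← mul_div_assoc, div_le_div_iff₀ (by positivity) (by positivity)]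
    have h3 := mul_le_mul_of_nonneg_right h1 (Nat.cast_nonneg (α := ℝ) k.factorial)
    linarith

end Kernel

/-- The Schur test for positive kernels. -/
theorem lintegral_rpow_lintegral_kernel_le {α : Type*} [MeasurableSpace α] {m : Measure α}
    [SFinite m] {k : α → α → ℝ≥0∞} (hk : Measurable (Function.uncurry k)) {w f : α → ℝ≥0∞}
    (hw : Measurable w) (hf : Measurable f) {p q : ℝ} (hpq : p.HolderConjugate q) {C : ℝ≥0∞}
    (hw0 : ∀ᵐ t ∂m, w t ≠ 0) (hwtop : ∀ᵐ t ∂m, w t ≠ ∞)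
    (h1 : ∀ᵐ s ∂m, ∫⁻ t, k s t * w t ^ q ∂m ≤ C * w s ^ q)
    (h2 : ∀ᵐ t ∂m, ∫⁻ s, k s t * w s ^ p ∂m ≤ C * w t ^ p) :
    ∫⁻ s, (∫⁻ t, k s t * f t ∂m) ^ p ∂m ≤ C ^ p * ∫⁻ t, f t ^ p ∂m := by
  have hp := hpq.pos
  have hq := hpq.symm.pos
  have hks : ∀ s, Measurable (k s) := fun s => hk.comp measurable_prodMk_left
  have hkt : ∀ t, Measurable fun s => k s t := fun t => hk.comp measurable_prodMk_right
  have hpq1 : p * (1 / q) + 1 = p := by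
    have := hpq.inv_add_inv_eq_one
    field_simp at this ⊢
    linarith
  have hexp : q * (p * (1 / q)) = p := by field_simp
  have hpoint : ∀ᵐ s ∂m, (∫⁻ t, k s t * f t ∂m) ^ p ≤
      ∫⁻ t, C ^ (p * (1 / q)) * w s ^ p * (k s t * (f t / w t) ^ p) ∂m := by
    filter_upwards [h1] with s hs
    have hHolder := ENNReal.lintegral_mul_le_Lp_mul_Lq m hpq.symm
      (f := fun t => k s t ^ (1 / q) * w t) (g := fun t => k s t ^ (1 / p) * (f t / w t))
      (((hks s).pow_const _).mul hw).aemeasurable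
      (((hks s).pow_const _).mul (hf.div hw)).aemeasurable
    have hL : ∫⁻ t, k s t * f t ∂m = ∫⁻ t, ((fun t => k s t ^ (1 / q) * w t) *
        fun t => k s t ^ (1 / p) * (f t / w t)) t ∂m := by
      refine lintegral_congr_ae ?_
      filter_upwards [hw0, hwtop] with t ht0 httop
      rw [Pi.mul_apply, mul_mul_mul_comm,
        ← ENNReal.rpow_add_of_nonneg _ _ (by positivity) (by positivity), one_div, one_div,
        hpq.symm.inv_add_inv_eq_one, ENNReal.rpow_one, ENNReal.mul_div_cancel ht0 httop]
    have hA : ∀ t, (k s t ^ (1 / q) * w t) ^ q = k s t * w t ^ q := fun t => by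
      rw [ENNReal.mul_rpow_of_nonneg _ _ hq.le, ← ENNReal.rpow_mul, one_div_mul_cancel hq.ne',
        ENNReal.rpow_one]
    have hB : ∀ t, (k s t ^ (1 / p) * (f t / w t)) ^ p = k s t * (f t / w t) ^ p := fun t => by
      rw [ENNReal.mul_rpow_of_nonneg _ _ hp.le, ← ENNReal.rpow_mul, one_div_mul_cancel hp.ne',
        ENNReal.rpow_one]
    simp_rw [hA, hB] at hHolder
    rw [← hL] at hHolder
    calc (∫⁻ t, k s t * f t ∂m) ^ p
        ≤ ((C * w s ^ q) ^ (1 / q) * (∫⁻ t, k s t * (f t / w t) ^ p ∂m) ^ (1 / p)) ^ p := by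
          refine ENNReal.rpow_le_rpow (hHolder.trans ?_) hp.le
          gcongr
      _ = C ^ (p * (1 / q)) * w s ^ p * ∫⁻ t, k s t * (f t / w t) ^ p ∂m := by
          rw [ENNReal.mul_rpow_of_nonneg _ _ hp.le, ← ENNReal.rpow_mul, ← ENNReal.rpow_mul,
            one_div_mul_cancel hp.ne', ENNReal.rpow_one, mul_comm (1 / q) p,
            ENNReal.mul_rpow_of_nonneg _ _ (by positivity), ← ENNReal.rpow_mul, hexp]
      _ = _ := (lintegral_const_mul _ ((hks s).mul ((hf.div hw).pow_const _))).symm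
  have hmeas : Measurable (Function.uncurry fun s t =>
      C ^ (p * (1 / q)) * w s ^ p * (k s t * (f t / w t) ^ p)) := by
    unfold Function.uncurry at hk ⊢
    fun_prop
  calc ∫⁻ s, (∫⁻ t, k s t * f t ∂m) ^ p ∂m
      ≤ ∫⁻ s, ∫⁻ t, C ^ (p * (1 / q)) * w s ^ p * (k s t * (f t / w t) ^ p) ∂m ∂m :=
        lintegral_mono_ae hpoint
    _ = ∫⁻ t, ∫⁻ s, C ^ (p * (1 / q)) * w s ^ p * (k s t * (f t / w t) ^ p) ∂m ∂m :=
        lintegral_lintegral_swap hmeas.aemeasurable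
    _ = ∫⁻ t, C ^ (p * (1 / q)) * (f t / w t) ^ p * ∫⁻ s, k s t * w s ^ p ∂m ∂m := by
        refine lintegral_congr fun t => ?_
        refine Eq.trans (lintegral_congr fun s => ?_)
          (lintegral_const_mul _ ((hkt t).mul (hw.pow_const _)))
        ring
    _ ≤ ∫⁻ t, C ^ p * f t ^ p ∂m := by
        refine lintegral_mono_ae ?_
        filter_upwards [h2, hw0, hwtop] with t ht ht0 httop
        calc C ^ (p * (1 / q)) * (f t / w t) ^ p * ∫⁻ s, k s t * w s ^ p ∂m
            ≤ C ^ (p * (1 / q)) * (f t / w t) ^ p * (C * w t ^ p) := by gcongr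
          _ = (C ^ (p * (1 / q)) * C ^ (1 : ℝ)) * ((f t / w t) ^ p * w t ^ p) := by
              rw [ENNReal.rpow_one]; ring
          _ = C ^ p * f t ^ p := by
              rw [← ENNReal.rpow_add_of_nonneg _ _ (by positivity) zero_le_one, hpq1,
                ← ENNReal.mul_rpow_of_nonneg _ _ hp.le, ENNReal.div_mul_cancel ht0 httop]
    _ = C ^ p * ∫⁻ t, f t ^ p ∂m := lintegral_const_mul _ (hf.pow_const _)

section OperatorNorm

theorem ofReal_one_sub_rpow_rpow {t : ℝ} (ht : t < 1) (x y : ℝ) :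
    ENNReal.ofReal ((1 - t) ^ x) ^ y = ENNReal.ofReal ((1 - t) ^ (x * y)) := by
  have h : 0 < 1 - t := by linarith
  rw [ENNReal.ofReal_rpow_of_pos (rpow_pos_of_pos h x), Real.rpow_mul h.le]

theorem ofReal_one_sub_rpow_mul {t : ℝ} (ht : t < 1) (x y : ℝ) :
    ENNReal.ofReal ((1 - t) ^ x) * ENNReal.ofReal ((1 - t) ^ y) =
      ENNReal.ofReal ((1 - t) ^ (x + y)) := by
  have h : 0 < 1 - t := by linarith
  rw [Real.rpow_add h, ENNReal.ofReal_mul (rpow_pos_of_pos h x).le]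

theorem Fop_eq_lintegral_gammaKernel {μ σ lam : ℝ} (hμ : 0 < μ) (hlam : μ < 2 * lam)
    (f : ℝ → ℝ≥0∞) {s : ℝ} (hs : s ∈ Ioo (0 : ℝ) 1) :
    Fop μ σ lam f s = ∫⁻ t, ENNReal.ofReal (Gamma μ / Gamma lam ^ 2) *
      ENNReal.ofReal ((1 - t) ^ σ) * gammaKernel lam μ s t * f t ∂(wMeasure μ) := by
  refine lintegral_congr_ae ?_
  filter_upwards [ae_wMeasure_mem_Ioo μ] with t ht
  have : 0 ≤ 1 - t := by linarith [ht.2]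
  rw [ENNReal.ofReal_mul (by positivity), ofReal_hyp2F1 hμ hlam hs ht]
  ring

theorem lintegral_gammaKernel_le {lam μ a b s : ℝ} (hμ : 0 < μ) (ha : 0 < a) (hb : 0 < b)
    (hlam : 2 * lam = a + (μ + b)) (hs : s ∈ Ioo (0 : ℝ) 1) :
    ENNReal.ofReal (Gamma μ / Gamma lam ^ 2) *
      ∫⁻ t, ENNReal.ofReal ((1 - t) ^ (b - 1)) * gammaKernel lam μ s t ∂(wMeasure μ) ≤
      ENNReal.ofReal (Gamma (μ + 1) / Gamma lam ^ 2 * Gamma a * Gamma b) *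
        ENNReal.ofReal ((1 - s) ^ (-a)) := by
  have hGμ := Gamma_pos_of_pos hμ
  have hGa := Gamma_pos_of_pos ha
  have hGb := Gamma_pos_of_pos hb
  rw [lintegral_gammaKernel hμ hb, Gamma_add_one hμ.ne',
    show μ * Gamma μ / Gamma lam ^ 2 * Gamma a * Gamma b =
      Gamma μ / Gamma lam ^ 2 * (μ * Gamma b * Gamma a) by ring,
    ENNReal.ofReal_mul (p := Gamma μ / Gamma lam ^ 2) (by positivity), mul_assoc,
    ENNReal.ofReal_mul (p := μ * Gamma b) (by positivity), mul_assoc (ENNReal.ofReal (μ * Gamma b))]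
  gcongr
  exact gammaSeries_le ha (by positivity) hlam hs

theorem lintegral_Fop_rpow_le {μ σ lam p : ℝ} (hμ : 0 < μ) (hp : 1 < p) (hσ : 1 / p - 1 < σ)
    (hlam : lam = (μ + σ + 1) / 2) {f : ℝ → ℝ≥0∞} (hf : Measurable f) :
    ∫⁻ s, Fop μ σ lam f s ^ p ∂(wMeasure μ) ≤
      ENNReal.ofReal (Gamma (μ + 1) / Gamma lam ^ 2 * Gamma (1 / p) * Gamma (σ + 1 - 1 / p)) ^ p *
        ∫⁻ t, f t ^ p ∂(wMeasure μ) := by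
  have hpq := Real.HolderConjugate.conjExponent hp
  set q := p.conjExponent
  have hp0 : 0 < p := hpq.pos
  have hq0 : 0 < q := hpq.symm.pos
  have hinv : 1 / p + 1 / q = 1 := by simpa using hpq.inv_add_inv_eq_one
  have ha : 0 < 1 / p := by positivity
  have hb : 0 < σ + 1 - 1 / p := by linarith
  have hml : μ < 2 * lam := by linarith
  have hFop : ∫⁻ s, Fop μ σ lam f s ^ p ∂(wMeasure μ) =
      ∫⁻ s, (∫⁻ t, ENNReal.ofReal (Gamma μ / Gamma lam ^ 2) *
        ENNReal.ofReal ((1 - t) ^ σ) * gammaKernel lam μ s t * f t ∂(wMeasure μ)) ^ p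
          ∂(wMeasure μ) := by
    refine lintegral_congr_ae ?_
    filter_upwards [ae_wMeasure_mem_Ioo μ] with s hs
    rw [Fop_eq_lintegral_gammaKernel hμ hml f hs]
  have hweight : ∀ᵐ t ∂(wMeasure μ), 0 < ENNReal.ofReal ((1 - t) ^ (-(1 / p * (1 / q)))) := by
    filter_upwards [ae_wMeasure_mem_Ioo μ] with t ht
    exact ENNReal.ofReal_pos.2 (rpow_pos_of_pos (by linarith [ht.2]) _)
  rw [hFop]
  refine lintegral_rpow_lintegral_kernel_le
    (k := fun s t => ENNReal.ofReal (Gamma μ / Gamma lam ^ 2) *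
        ENNReal.ofReal ((1 - t) ^ σ) * gammaKernel lam μ s t)
    (w := fun t => ENNReal.ofReal ((1 - t) ^ (-(1 / p * (1 / q)))))
    ?_ (by fun_prop) hf hpq (hweight.mono fun t ht => ht.ne')
    (ae_of_all _ fun t => ENNReal.ofReal_ne_top) ?_ ?_
  · exact Measurable.mul (by fun_prop) (measurable_gammaKernel lam μ)
  · filter_upwards [ae_wMeasure_mem_Ioo μ] with s hs
    have hexp : -(1 / p * (1 / q)) * q = -(1 / p) := by field_simp
    rw [ofReal_one_sub_rpow_rpow hs.2, hexp]
    refine le_of_eq_of_le ?_ (lintegral_gammaKernel_le hμ ha hb (by linarith) hs)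
    rw [← lintegral_const_mul _ (measurable_rpow_mul_gammaKernel lam μ _ _)]
    refine lintegral_congr_ae ?_
    filter_upwards [ae_wMeasure_mem_Ioo μ] with t ht
    rw [ofReal_one_sub_rpow_rpow ht.2, hexp,
      show σ + 1 - 1 / p - 1 = σ + -(1 / p) by ring, ← ofReal_one_sub_rpow_mul ht.2]
    ring
  · filter_upwards [ae_wMeasure_mem_Ioo μ] with t ht
    have hexp : -(1 / p * (1 / q)) * p = 1 / p - 1 := by
      rw [show 1 / p - 1 = -(1 / q) by linarith]
      field_simp
    have hint : ∫⁻ s, ENNReal.ofReal (Gamma μ / Gamma lam ^ 2) * ENNReal.ofReal ((1 - t) ^ σ) *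
        gammaKernel lam μ s t * ENNReal.ofReal ((1 - s) ^ (-(1 / p * (1 / q)))) ^ p ∂(wMeasure μ) =
        ENNReal.ofReal ((1 - t) ^ σ) * (ENNReal.ofReal (Gamma μ / Gamma lam ^ 2) *
          ∫⁻ s, ENNReal.ofReal ((1 - s) ^ (1 / p - 1)) * gammaKernel lam μ t s ∂(wMeasure μ)) := by
      rw [← mul_assoc, ← lintegral_const_mul _ (measurable_rpow_mul_gammaKernel lam μ _ _)]
      refine lintegral_congr_ae ?_
      filter_upwards [ae_wMeasure_mem_Ioo μ] with s hs
      rw [ofReal_one_sub_rpow_rpow hs.2, hexp, gammaKernel_comm lam μ s t]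
      ring
    rw [hint, ofReal_one_sub_rpow_rpow ht.2, hexp]
    calc _ ≤ ENNReal.ofReal ((1 - t) ^ σ) * (ENNReal.ofReal (Gamma (μ + 1) / Gamma lam ^ 2 *
            Gamma (σ + 1 - 1 / p) * Gamma (1 / p)) *
            ENNReal.ofReal ((1 - t) ^ (-(σ + 1 - 1 / p)))) :=
          mul_le_mul_right (lintegral_gammaKernel_le hμ hb ha (by linarith) ht) _
      _ = _ := by
          rw [mul_left_comm, ofReal_one_sub_rpow_mul ht.2, mul_right_comm (_ / _),
            show σ + -(σ + 1 - 1 / p) = 1 / p - 1 by ring]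

theorem Fop_one_sub_rpow {μ σ lam x s : ℝ} (hμ : 0 < μ) (hlam : μ < 2 * lam) (hx : 0 < σ + 1 + x)
    (hs : s ∈ Ioo (0 : ℝ) 1) :
    Fop μ σ lam (fun t => ENNReal.ofReal ((1 - t) ^ x)) s =
      ENNReal.ofReal (Gamma (μ + 1) / Gamma lam ^ 2 * Gamma (σ + 1 + x)) *
        gammaSeries lam (μ + (σ + 1 + x)) s := by
  have hGμ := Gamma_pos_of_pos hμ
  rw [Fop_eq_lintegral_gammaKernel hμ hlam _ hs, Gamma_add_one hμ.ne',
    show μ * Gamma μ / Gamma lam ^ 2 * Gamma (σ + 1 + x) =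
      Gamma μ / Gamma lam ^ 2 * (μ * Gamma (σ + 1 + x)) by ring,
    ENNReal.ofReal_mul (by positivity), mul_assoc, ← lintegral_gammaKernel hμ hx,
    ← lintegral_const_mul _ (measurable_rpow_mul_gammaKernel lam μ _ _)]
  refine lintegral_congr_ae ?_
  filter_upwards [ae_wMeasure_mem_Ioo μ] with t ht
  rw [show σ + 1 + x - 1 = σ + x by ring, ← ofReal_one_sub_rpow_mul ht.2]
  ring

/-- The `L^p` norm of `(1 - t) ^ (ε - 1 / p)`. -/
theorem lintegral_one_sub_rpow_rpow {μ p ε : ℝ} (hμ : 0 < μ) (hp : 0 < p) (hε : 0 < ε) :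
    (∫⁻ t, ENNReal.ofReal ((1 - t) ^ (ε - 1 / p)) ^ p ∂(wMeasure μ)) ^ (1 / p) =
      ENNReal.ofReal ((Gamma (μ + 1) * Gamma (ε * p) / Gamma (μ + ε * p)) ^ (1 / p)) := by
  have hεp : 0 < ε * p := by positivity
  have h := lintegral_one_sub_rpow_mul_pow hμ hεp 0
  have h1 := Gamma_pos_of_pos (show 0 < μ + 1 by positivity)
  have h2 := Gamma_pos_of_pos hεp
  have h3 := Gamma_pos_of_pos (show 0 < μ + ε * p by positivity)
  simp only [pow_zero, mul_one, Nat.cast_zero, add_zero] at h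
  rw [← mul_div_assoc, ← mul_assoc, ← Gamma_add_one hμ.ne'] at h
  rw [← ENNReal.ofReal_rpow_of_pos (by positivity), ← h]
  congr 1
  refine lintegral_congr_ae ?_
  filter_upwards [ae_wMeasure_mem_Ioo μ] with t ht
  rw [ofReal_one_sub_rpow_rpow ht.2]
  congr 2
  field_simp

theorem wMeasure_univ {μ : ℝ} (hμ : 0 < μ) : wMeasure μ univ = 1 := by
  have h := lintegral_one_sub_rpow_mul_pow hμ one_pos 0
  have hG := (Gamma_pos_of_pos (show 0 < μ + 1 by positivity)).ne'
  simpa [← mul_div_assoc, ← Gamma_add_one hμ.ne', hG] using h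

theorem tendsto_norm_one_sub_rpow_atTop {μ p : ℝ} (hμ : 0 < μ) (hp : 0 < p) :
    Tendsto (fun ε : ℝ => (Gamma (μ + 1) * Gamma (ε * p) / Gamma (μ + ε * p)) ^ (1 / p))
      (𝓝[>] 0) atTop := by
  refine (tendsto_rpow_atTop (by positivity)).comp ?_
  have hεp : Tendsto (fun ε : ℝ => ε * p) (𝓝[>] 0) (𝓝[>] 0) := by
    refine tendsto_nhdsWithin_iff.2 ⟨?_, ?_⟩
    · refine Tendsto.mono_left ?_ nhdsWithin_le_nhds
      exact Continuous.tendsto' (by fun_prop) _ _ (by simp)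
    · filter_upwards [self_mem_nhdsWithin] with ε hε
      exact mul_pos hε hp
  have hGμ := Gamma_pos_of_pos hμ
  have hGμ1 := Gamma_pos_of_pos (show 0 < μ + 1 by positivity)
  have hlim : Tendsto (fun x : ℝ => Gamma (μ + 1) * Gamma (x + 1) / Gamma (μ + x)) (𝓝[>] 0)
      (𝓝 (Gamma (μ + 1) * 1 / Gamma μ)) := by
    refine Tendsto.mono_left ?_ nhdsWithin_le_nhds
    refine Tendsto.div (Tendsto.const_mul _ ?_) ?_ hGμ.ne'
    · exact Gamma_one ▸ (continuousAt_Gamma_of_pos one_pos).tendsto.comp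
        (Continuous.tendsto' (by fun_prop) _ _ (by simp))
    · exact (continuousAt_Gamma_of_pos hμ).tendsto.comp
        (Continuous.tendsto' (by fun_prop) _ _ (by simp))
  have hmain : Tendsto (fun x : ℝ => Gamma (μ + 1) * Gamma x / Gamma (μ + x)) (𝓝[>] 0) atTop := by
    refine (tendsto_inv_nhdsGT_zero.atTop_mul_pos (by positivity) hlim).congr' ?_
    filter_upwards [self_mem_nhdsWithin] with x hx
    have hx0 : x ≠ 0 := ne_of_gt hx
    rw [Gamma_add_one hx0]
    field_simp
  exact hmain.comp hεp

/-- Every bound for `F_σ` on `L^p_μ` almost bounds the constant, as seen on `(1 - t) ^ (ε - 1 / p)`,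
with an error that does not depend on `ε`. -/
theorem exists_mul_norm_le {μ σ lam p θ c : ℝ} (hμ : 0 < μ) (hp : 1 < p) (hσ : 1 / p - 1 < σ)
    (hlam : lam = (μ + σ + 1) / 2) (hθ0 : 0 < θ) (hθ : θ < 1) (hc : 0 ≤ c)
    (hC : ∀ f : ℝ → ℝ≥0∞, Measurable f →
        (∫⁻ s, Fop μ σ lam f s ^ p ∂(wMeasure μ)) ^ (1 / p) ≤
          ENNReal.ofReal c * (∫⁻ t, f t ^ p ∂(wMeasure μ)) ^ (1 / p)) :
    ∃ M : ℝ, ∀ ε ∈ Ioo 0 (1 / p / 2), ∀ n : ℝ,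
      n = (Gamma (μ + 1) * Gamma (ε * p) / Gamma (μ + ε * p)) ^ (1 / p) →
      Gamma (μ + 1) / Gamma lam ^ 2 * Gamma (σ + 1 - 1 / p + ε) * (θ * Gamma (1 / p - ε)) * n ≤
        c * n + Gamma (μ + 1) / Gamma lam ^ 2 * Gamma (σ + 1 - 1 / p + ε) * M := by
  have hp0 : 0 < p := by linarith
  have ha : 0 < 1 / p := by positivity
  obtain ⟨M, hM0, hM⟩ := exists_le_gammaSeries_add lam ha hθ0 hθ
  refine ⟨M, fun ε hε n hn => ?_⟩
  obtain ⟨hε0, hε1⟩ := hε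
  have hb : 0 < σ + 1 - 1 / p + ε := by linarith
  have hGμ := Gamma_pos_of_pos (show 0 < μ + 1 by positivity)
  have hGb := Gamma_pos_of_pos hb
  have hGl := Gamma_pos_of_pos (show 0 < lam by linarith)
  have hGa := Gamma_pos_of_pos (show 0 < 1 / p - ε by linarith)
  have hn0 : 0 ≤ n := by
    have h2 := Gamma_pos_of_pos (show 0 < ε * p by positivity)
    have h3 := Gamma_pos_of_pos (show 0 < μ + ε * p by positivity)
    rw [hn]
    positivity
  set D := Gamma (μ + 1) / Gamma lam ^ 2 * Gamma (σ + 1 - 1 / p + ε) with hD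
  have hD0 : 0 < D := by positivity
  have hnorm := lintegral_one_sub_rpow_rpow hμ hp0 hε0
  rw [← hn] at hnorm
  have hpoint : ∀ s ∈ Ioo (0 : ℝ) 1,
      ENNReal.ofReal (D * (θ * Gamma (1 / p - ε))) * ENNReal.ofReal ((1 - s) ^ (ε - 1 / p)) ≤
        Fop μ σ lam (fun t => ENNReal.ofReal ((1 - t) ^ (ε - 1 / p))) s +
          ENNReal.ofReal (D * M) := by
    intro s hs
    rw [Fop_one_sub_rpow hμ (by linarith) (by linarith) hs,
      show σ + 1 + (ε - 1 / p) = σ + 1 - 1 / p + ε by ring, ← hD,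
      ENNReal.ofReal_mul hD0.le, ENNReal.ofReal_mul hD0.le, mul_assoc, ← mul_add]
    gcongr
    have := hM (1 / p - ε) ⟨by linarith, by linarith⟩ (μ + (σ + 1 - 1 / p + ε))
      (by positivity) (by rw [hlam]; ring) s hs
    rwa [neg_sub] at this
  have hFm : AEMeasurable (Fop μ σ lam fun t => ENNReal.ofReal ((1 - t) ^ (ε - 1 / p)))
      (wMeasure μ) := by
    refine ((measurable_gammaSeries lam (μ + (σ + 1 + (ε - 1 / p)))).const_mul (ENNReal.ofReal
      (Gamma (μ + 1) / Gamma lam ^ 2 * Gamma (σ + 1 + (ε - 1 / p))))).aemeasurable.congr ?_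
    filter_upwards [ae_wMeasure_mem_Ioo μ] with s hs
    exact (Fop_one_sub_rpow hμ (by linarith) (by linarith) hs).symm
  have hENN : ENNReal.ofReal (D * (θ * Gamma (1 / p - ε))) * ENNReal.ofReal n ≤
      ENNReal.ofReal c * ENNReal.ofReal n + ENNReal.ofReal (D * M) := by
    calc ENNReal.ofReal (D * (θ * Gamma (1 / p - ε))) * ENNReal.ofReal n
        = (∫⁻ s, (ENNReal.ofReal (D * (θ * Gamma (1 / p - ε))) *
            ENNReal.ofReal ((1 - s) ^ (ε - 1 / p))) ^ p ∂(wMeasure μ)) ^ (1 / p) := by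
          simp_rw [ENNReal.mul_rpow_of_nonneg _ _ hp0.le]
          rw [lintegral_const_mul _ (by fun_prop), ENNReal.mul_rpow_of_nonneg _ _ ha.le, hnorm,
            ← ENNReal.rpow_mul, mul_one_div_cancel hp0.ne', ENNReal.rpow_one]
      _ ≤ (∫⁻ s, ((Fop μ σ lam fun t => ENNReal.ofReal ((1 - t) ^ (ε - 1 / p))) +
            (fun _ => ENNReal.ofReal (D * M)) : ℝ → ℝ≥0∞) s ^ p ∂(wMeasure μ)) ^ (1 / p) := by
          refine ENNReal.rpow_le_rpow (lintegral_mono_ae ?_) ha.le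
          filter_upwards [ae_wMeasure_mem_Ioo μ] with s hs
          exact ENNReal.rpow_le_rpow (hpoint s hs) hp0.le
      _ ≤ _ := ENNReal.lintegral_Lp_add_le hFm aemeasurable_const hp.le
      _ ≤ ENNReal.ofReal c * ENNReal.ofReal n + ENNReal.ofReal (D * M) := by
          rw [← hnorm]
          refine add_le_add (hC _ (by fun_prop)) (le_of_eq ?_)
          rw [lintegral_const, wMeasure_univ hμ, mul_one, ← ENNReal.rpow_mul,
            mul_one_div_cancel hp0.ne', ENNReal.rpow_one]
  rw [← ENNReal.ofReal_mul (by positivity), ← ENNReal.ofReal_mul hc,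
    ← ENNReal.ofReal_add (by positivity) (by positivity),
    ENNReal.ofReal_le_ofReal_iff (by positivity)] at hENN
  exact hENN

theorem le_of_Fop_bound {μ σ lam p c : ℝ} (hμ : 0 < μ) (hp : 1 < p) (hσ : 1 / p - 1 < σ)
    (hlam : lam = (μ + σ + 1) / 2) (hc : 0 ≤ c)
    (hC : ∀ f : ℝ → ℝ≥0∞, Measurable f →
        (∫⁻ s, Fop μ σ lam f s ^ p ∂(wMeasure μ)) ^ (1 / p) ≤
          ENNReal.ofReal c * (∫⁻ t, f t ^ p ∂(wMeasure μ)) ^ (1 / p)) :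
    Gamma (μ + 1) / Gamma lam ^ 2 * Gamma (1 / p) * Gamma (σ + 1 - 1 / p) ≤ c := by
  have hp0 : 0 < p := by linarith
  have ha : 0 < 1 / p := by positivity
  have hb : 0 < σ + 1 - 1 / p := by linarith
  have hθ : ∀ θ ∈ Ioo (0 : ℝ) 1, Gamma (μ + 1) / Gamma lam ^ 2 * Gamma (σ + 1 - 1 / p) *
      (θ * Gamma (1 / p)) ≤ c := by
    rintro θ ⟨hθ0, hθ1⟩
    obtain ⟨M, hM⟩ := exists_mul_norm_le hμ hp hσ hlam hθ0 hθ1 hc hC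
    have hn := tendsto_norm_one_sub_rpow_atTop hμ hp0
    have hGb : Tendsto (fun ε : ℝ => Gamma (μ + 1) / Gamma lam ^ 2 * Gamma (σ + 1 - 1 / p + ε))
        (𝓝[>] 0) (𝓝 (Gamma (μ + 1) / Gamma lam ^ 2 * Gamma (σ + 1 - 1 / p))) := by
      refine Tendsto.mono_left (Tendsto.const_mul _ ?_) nhdsWithin_le_nhds
      exact (continuousAt_Gamma_of_pos hb).tendsto.comp
        (Continuous.tendsto' (by fun_prop) _ _ (by simp))
    have hGa : Tendsto (fun ε : ℝ => θ * Gamma (1 / p - ε)) (𝓝[>] 0) (𝓝 (θ * Gamma (1 / p))) := by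
      refine Tendsto.mono_left (Tendsto.const_mul _ ?_) nhdsWithin_le_nhds
      exact (continuousAt_Gamma_of_pos ha).tendsto.comp
        (Continuous.tendsto' (by fun_prop) _ _ (by simp))
    have hR := tendsto_const_nhds (x := c).add ((hGb.mul_const M).div_atTop hn)
    rw [add_zero] at hR
    refine le_of_tendsto_of_tendsto (hGb.mul hGa) hR ?_
    filter_upwards [Ioo_mem_nhdsGT (show (0 : ℝ) < 1 / p / 2 by positivity),
      hn.eventually_gt_atTop 0] with ε hε hn0
    have h := hM ε hε _ rfl
    rw [← sub_le_iff_le_add', le_div_iff₀ hn0, sub_mul]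
    linarith
  have hlim : Tendsto (fun θ : ℝ => Gamma (μ + 1) / Gamma lam ^ 2 * Gamma (σ + 1 - 1 / p) *
      (θ * Gamma (1 / p))) (𝓝[<] 1)
      (𝓝 (Gamma (μ + 1) / Gamma lam ^ 2 * Gamma (1 / p) * Gamma (σ + 1 - 1 / p))) := by
    refine Tendsto.mono_left ?_ nhdsWithin_le_nhds
    exact Continuous.tendsto' (by fun_prop) _ _ (by ring)
  refine le_of_tendsto hlim ?_
  filter_upwards [Ioo_mem_nhdsLT (zero_lt_one' ℝ)] with θ h using hθ θ h

end OperatorNorm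

/-- For `1 < p < ∞` and `σ > 1/p - 1`, the operator norm of `F_σ` on `L^p_μ(0,1)`
equals exactly `(Γ(μ+1)/Γ(λ)²) Γ(1/p) Γ(σ+1-1/p)`, where `λ = (μ+σ+1)/2`. -/
theorem Fop_lp_norm (μ σ lam p : ℝ) (hμ : 0 < μ) (hp : 1 < p)
    (hσ : 1 / p - 1 < σ) (hlam : lam = (μ + σ + 1) / 2) :
    sInf {C : ℝ≥0∞ | ∀ f : ℝ → ℝ≥0∞, Measurable f →
        (∫⁻ s, Fop μ σ lam f s ^ p ∂(wMeasure μ)) ^ (1 / p) ≤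
          C * (∫⁻ t, f t ^ p ∂(wMeasure μ)) ^ (1 / p)} =
      ENNReal.ofReal (Real.Gamma (μ + 1) / Real.Gamma lam ^ 2 *
        Real.Gamma (1 / p) * Real.Gamma (σ + 1 - 1 / p)) := by
  have hp0 : 0 < p := by linarith
  refine le_antisymm (sInf_le fun f hf => ?_) (le_sInf fun C hC => ?_)
  · refine (ENNReal.rpow_le_rpow (lintegral_Fop_rpow_le hμ hp hσ hlam hf)
      (by positivity)).trans_eq ?_
    rw [ENNReal.mul_rpow_of_nonneg _ _ (by positivity), ← ENNReal.rpow_mul,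
      mul_one_div_cancel hp0.ne', ENNReal.rpow_one]
  · rcases eq_or_ne C ∞ with rfl | hCtop
    · exact le_top
    · rw [← ENNReal.ofReal_toReal hCtop] at hC ⊢
      exact ENNReal.ofReal_le_ofReal
        (le_of_Fop_bound hμ hp hσ hlam ENNReal.toReal_nonneg hC)
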